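/- arXiv:0811.2021 — 2 statements merged into one kernel-verified Lean document; each statement's English description precedes it below -/
import Mathlib

section
/- Let R be an associative unital ring, let L be a unit of R, and let M ∈ R satisfy M*L - L*M = -1. Then for every positive integer k, setting l = 2k and A := 2*M*L^(-(l-1)) - l*L^(-l), the commutator identity A*L^l - L^l*A = -2*l holds (equivalently, [L^l, A] = 2l·1). -/
theorem commutator_pow_succ_of_commutator_eq_neg_one {R : Type*} [Ring R] {L M : R}
    (h : M * L - L * M = -1) (n : ℕ) :
    M * L ^ (n + 1) - L ^ (n + 1) * M = -((n + 1 : ℕ) : R) * L ^ n := by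
  induction n with
  | zero => simpa using h
  | succ n ih =>
    have split : M * L ^ (n + 2) - L ^ (n + 2) * M =
        (M * L ^ (n + 1) - L ^ (n + 1) * M) * L + L ^ (n + 1) * (M * L - L * M) := by
      rw [pow_succ L (n + 1)]
      noncomm_ring
    rw [split, ih, h, mul_assoc, ← pow_succ]
    push_cast
    noncomm_ring


/-- In an associative unital ring with `L` a unit and `M * L - L * M = -1`,
for every positive integer `k`, setting `l = 2k` and
`A = 2 * M * L^(-(l-1)) - l * L^(-l)` (the additional-symmetry generator
`A_{1,-(l-1)}` of the BKP hierarchy), we have `[A, L^l] = -2l`, equivalently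
`[L^l, A] = 2l` (eq. (18) of the paper). -/
theorem commutator_A_pow_L {R : Type*} [Ring R] (L : Rˣ) (M : R)
    (h : M * (L : R) - (L : R) * M = -1)
    (k : ℕ) (hk : 0 < k) (l : ℤ) (hl : l = 2 * k) :
    (2 * (M * ((L ^ (-(l - 1)) : Rˣ) : R)) - (l : R) * ((L ^ (-l) : Rˣ) : R)) * ((L ^ l : Rˣ) : R)
      - ((L ^ l : Rˣ) : R) * (2 * (M * ((L ^ (-(l - 1)) : Rˣ) : R)) - (l : R) * ((L ^ (-l) : Rˣ) : R))
      = -((2 * l : ℤ) : R) := by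
  obtain ⟨n, rfl⟩ : ∃ n : ℕ, l = (n + 1 : ℕ) := ⟨2 * k - 1, by omega⟩
  have commutator := commutator_pow_succ_of_commutator_eq_neg_one h n
  have hshift : -(((n + 1 : ℕ) : ℤ) - 1) = -(n : ℤ) := by push_cast; ring
  rw [hshift, zpow_neg, zpow_neg, zpow_natCast, zpow_natCast]
  have cancel : ((L ^ n)⁻¹ : Rˣ).val * (L ^ (n + 1) : Rˣ).val =
      (L ^ (n + 1) : Rˣ).val * ((L ^ n)⁻¹ : Rˣ).val := by
    rw [← Units.val_mul, ← Units.val_mul,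
      (((Commute.refl L).pow_pow n (n + 1)).inv_left).eq]
  have cast_comm : ((L ^ (n + 1) : Rˣ) : R) * ((n + 1 : ℕ) : R) =
      ((n + 1 : ℕ) : R) * ((L ^ (n + 1) : Rˣ) : R) := (Nat.cast_commute _ _).symm
  simp only [← Units.val_pow_eq_pow_val] at commutator
  calc
    _ = 2 * ((M * ((L ^ (n + 1) : Rˣ) : R) - ((L ^ (n + 1) : Rˣ) : R) * M) *
          ((L ^ n)⁻¹ : Rˣ).val) := by
      rw [sub_mul, mul_sub, Int.cast_natCast, mul_assoc 2, mul_assoc M, cancel,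
        mul_assoc _ _ ((L ^ (n + 1) : Rˣ) : R), Units.inv_mul,
        ← mul_assoc _ ((n + 1 : ℕ) : R), cast_comm,
        mul_assoc _ ((L ^ (n + 1) : Rˣ) : R), Units.mul_inv]
      noncomm_ring
    _ = _ := by
      rw [commutator, mul_assoc, Units.mul_inv]
      push_cast
      noncomm_ring
end

section
/- Let R be an associative unital algebra over ℚ, let L be a unit of R, and let M ∈ R satisfy M*L - L*M = -1. Then for every positive integer k, the commutator identity [L^(2k), (1/(2k))*M*L^(-(2k-1)) - (1/2)*L^(-2k)] = 1 holds, i.e., L^(2k)*((1/(2k))*M*L^(-(2k-1)) - (1/2)*L^(-2k)) - ((1/(2k))*M*L^(-(2k-1)) - (1/2)*L^(-2k))*L^(2k) = 1. -/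
/-- If `[x, y] = 1`, then `[x ^ (n + 1), y] = (n + 1) x ^ n`. -/
theorem pow_succ_mul_eq_of_commutator_eq_one {R : Type*} [Ring R] {x y : R}
    (h : x * y = y * x + 1) (n : ℕ) :
    x ^ (n + 1) * y = y * x ^ (n + 1) + ((n : R) + 1) * x ^ n := by
  induction n with
  | zero => simpa using h
  | succ n ih =>
    have hc : x * (n : R) = n * x := (Nat.cast_commute n x).eq.symm
    calc x ^ (n + 1 + 1) * y = x * (x ^ (n + 1) * y) := by rw [pow_succ' x (n + 1), mul_assoc]
      _ = (x * y) * x ^ (n + 1) + (x * ((n : R) + 1)) * x ^ n := by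
        rw [ih, mul_add, mul_assoc, mul_assoc]
      _ = y * (x * x ^ (n + 1)) + x ^ (n + 1) + ((n : R) + 1) * (x * x ^ n) := by
        rw [h, mul_add, hc]; noncomm_ring
      _ = y * x ^ (n + 1 + 1) + (((n + 1 : ℕ) : R) + 1) * x ^ (n + 1) := by
        rw [← pow_succ', ← pow_succ']; push_cast; noncomm_ring

/-- If `[x, y] = 1` with `x` a unit, then `[x ^ n, y x ^ (-(n - 1))] = n`. -/
theorem Units.commutator_zpow_mul_zpow_of_commutator_eq_one {R : Type*} [Ring R] {x : Rˣ} {y : R}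
    (h : (x : R) * y = y * x + 1) {n : ℕ} (hn : 0 < n) :
    ((x ^ (n : ℤ) : Rˣ) : R) * (y * ((x ^ (-((n : ℤ) - 1)) : Rˣ) : R))
      - y * ((x ^ (-((n : ℤ) - 1)) : Rˣ) : R) * ((x ^ (n : ℤ) : Rˣ) : R) = n := by
  obtain ⟨m, rfl⟩ := Nat.exists_eq_add_of_lt hn
  have hm : -(((0 + m + 1 : ℕ) : ℤ) - 1) = -(m : ℤ) := by push_cast; ring
  have hcomm := congrArg (Units.val : Rˣ → R)
    (zpow_mul_comm x (-(m : ℤ)) ((0 + m + 1 : ℕ) : ℤ))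
  have hinv : (x : R) ^ m * ((x ^ (-(m : ℤ)) : Rˣ) : R) = 1 := by
    rw [zpow_neg, zpow_natCast, ← Units.val_pow_eq_pow_val, Units.mul_inv]
  rw [Units.val_mul, Units.val_mul] at hcomm
  rw [hm, mul_assoc y, hcomm, ← mul_assoc, ← mul_assoc y, ← sub_mul, zpow_natCast,
    Units.val_pow_eq_pow_val, zero_add, pow_succ_mul_eq_of_commutator_eq_one h,
    add_sub_cancel_left, mul_assoc, hinv, mul_one, Nat.cast_succ]

/-- String equation of the BKP hierarchy (eq. (20), Proposition 3 of the paper):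
in an associative unital `ℚ`-algebra with `L` a unit and `M * L - L * M = -1`,
for every positive integer `k`,
`[L^(2k), (1/(2k)) * M * L^(-(2k-1)) - (1/2) * L^(-2k)] = 1`. -/
theorem string_equation_BKP {R : Type*} [Ring R] [Algebra ℚ R] (L : Rˣ) (M : R)
    (h : M * (L : R) - (L : R) * M = -1) (k : ℕ) (hk : 0 < k) :
    ((L ^ (2 * (k : ℤ)) : Rˣ) : R) *
        ((1 / (2 * (k : ℚ))) • (M * ((L ^ (-(2 * (k : ℤ) - 1)) : Rˣ) : R))
          - (1 / 2 : ℚ) • ((L ^ (-(2 * (k : ℤ))) : Rˣ) : R))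
      - ((1 / (2 * (k : ℚ))) • (M * ((L ^ (-(2 * (k : ℤ) - 1)) : Rˣ) : R))
          - (1 / 2 : ℚ) • ((L ^ (-(2 * (k : ℤ))) : Rˣ) : R)) *
        ((L ^ (2 * (k : ℤ)) : Rˣ) : R)
      = 1 := by
  have h' : (L : R) * M = M * L + 1 := by
    rw [eq_comm, ← sub_eq_zero, add_sub_right_comm, h, neg_add_cancel]
  have hcomm := Units.commutator_zpow_mul_zpow_of_commutator_eq_one h' (n := 2 * k) (by omega)
  have hpow := congrArg (Units.val : Rˣ → R) (zpow_mul_comm L (2 * (k : ℤ)) (-(2 * (k : ℤ))))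
  rw [Units.val_mul, Units.val_mul] at hpow
  have hk' : (2 * (k : ℚ)) ≠ 0 := by positivity
  have hcast : ((2 * k : ℕ) : R) = (2 * (k : ℚ)) • (1 : R) := by
    rw [← Algebra.algebraMap_eq_smul_one, ← map_natCast (algebraMap ℚ R)]; push_cast; rfl
  rw [hcast] at hcomm
  push_cast at hcomm
  rw [mul_sub, sub_mul, mul_smul_comm, mul_smul_comm, smul_mul_assoc, smul_mul_assoc, hpow,
    sub_sub_sub_cancel_right, ← smul_sub, hcomm, smul_smul, one_div_mul_cancel hk', one_smul]
end
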